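/- arXiv:1902.03513 — 2 statements merged into one kernel-verified Lean document; each statement's English description precedes it below -/
import Mathlib

section
/- The map C ↦ 𝒬(C) := {ρ density matrix in ℂ^{n×n} : Tr(Gρ) ≥ 0 for every Hermitian G whose associated gamble (⊗_j x_j)†G(⊗_j x_j) belongs to C} is a bijection between the family of P-coherent sets of desirable gambles C ⊆ 𝓛_R and the family of nonempty closed convex sets of n×n density matrices. -/
open Matrix
open scoped ComplexOrder

noncomputable section

/-- Index type for `n = n₁⋯n_m`-dimensional Kronecker products: tuples. -/
abbrev QIdx (m : ℕ) (nd : Fin m → ℕ) := ∀ j : Fin m, Fin (nd j)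

/-- The possibility space `Ω`: `m`-tuples of unit vectors `x_j ∈ ℂ^{n_j}`. -/
abbrev QOmega (m : ℕ) (nd : Fin m → ℕ) :=
  ∀ j : Fin m, {v : Fin (nd j) → ℂ // star v ⬝ᵥ v = 1}

/-- Entries of the Kronecker product `x₁ ⊗ ⋯ ⊗ x_m`. -/
def kronVec {m : ℕ} {nd : Fin m → ℕ} (x : ∀ j : Fin m, Fin (nd j) → ℂ) :
    QIdx m nd → ℂ :=
  fun k => ∏ j, x j (k j)

/-- The gamble associated to a matrix `G`: `(x₁,…,x_m) ↦ (⊗ⱼ xⱼ)† G (⊗ⱼ xⱼ)`. -/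
def qGamble {m : ℕ} {nd : Fin m → ℕ} (G : Matrix (QIdx m nd) (QIdx m nd) ℂ) :
    QOmega m nd → ℝ :=
  fun x => (star (kronVec fun j => (x j).1) ⬝ᵥ G *ᵥ kronVec fun j => (x j).1).re

/-- `Σ≥`: the gambles whose matrix is positive semidefinite. -/
def SigmaPSD (m : ℕ) (nd : Fin m → ℕ) : Set (QOmega m nd → ℝ) :=
  {g | ∃ G : Matrix (QIdx m nd) (QIdx m nd) ℂ, G.PosSemidef ∧ g = qGamble G}

/-- `Σ<`: the gambles whose matrix is negative definite. -/
def SigmaND (m : ℕ) (nd : Fin m → ℕ) : Set (QOmega m nd → ℝ) :=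
  {g | ∃ G : Matrix (QIdx m nd) (QIdx m nd) ℂ, (-G).PosDef ∧ g = qGamble G}

/-- `𝓛_R`: the gambles coming from Hermitian matrices. -/
def LRq (m : ℕ) (nd : Fin m → ℕ) : Set (QOmega m nd → ℝ) :=
  {g | ∃ G : Matrix (QIdx m nd) (QIdx m nd) ℂ, G.IsHermitian ∧ g = qGamble G}

/-- `posi S`: all finite nonnegative linear combinations of elements of `S`. -/
def posi {m : ℕ} {nd : Fin m → ℕ} (S : Set (QOmega m nd → ℝ)) :
    Set (QOmega m nd → ℝ) :=
  {h | ∃ (ℓ : ℕ) (lam : Fin ℓ → ℝ) (gs : Fin ℓ → QOmega m nd → ℝ),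
    (∀ i, 0 ≤ lam i) ∧ (∀ i, gs i ∈ S) ∧ h = fun x => ∑ i, lam i * gs i x}

/-- P-coherence: `C = cl (posi (Σ≥ ∪ 𝒢))` for some `𝒢 ⊆ 𝓛_R`, and `C ∩ Σ< = ∅`. -/
def PCoh (m : ℕ) (nd : Fin m → ℕ) (C : Set (QOmega m nd → ℝ)) : Prop :=
  (∃ 𝒢 ⊆ LRq m nd, C = closure (posi (SigmaPSD m nd ∪ 𝒢))) ∧ C ∩ SigmaND m nd = ∅

/-- The set of `n × n` density matrices. -/
def densities (m : ℕ) (nd : Fin m → ℕ) : Set (Matrix (QIdx m nd) (QIdx m nd) ℂ) :=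
  {ρ | ρ.PosSemidef ∧ ρ.trace = 1}

/-- The dual map `C ↦ 𝒬(C)`: the density matrices `ρ` with `Tr(Gρ) ≥ 0` for every
Hermitian `G` whose gamble lies in `C`. -/
def QMap (m : ℕ) (nd : Fin m → ℕ) (C : Set (QOmega m nd → ℝ)) :
    Set (Matrix (QIdx m nd) (QIdx m nd) ℂ) :=
  {ρ | ρ ∈ densities m nd ∧ ∀ G : Matrix (QIdx m nd) (QIdx m nd) ℂ,
    G.IsHermitian → qGamble G ∈ C → 0 ≤ (G * ρ).trace}

section MatrixTrace

variable {n : Type*} [Fintype n]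

lemma trace_mul_vecMulVec_star (G : Matrix n n ℂ) (a : n → ℂ) :
    (G * vecMulVec a (star a)).trace = star a ⬝ᵥ G *ᵥ a := by
  rw [mul_vecMulVec, trace_vecMulVec, dotProduct_comm]

lemma Matrix.IsHermitian.im_trace_mul_eq_zero {A B : Matrix n n ℂ} (hA : A.IsHermitian)
    (hB : B.IsHermitian) : (A * B).trace.im = 0 := by
  have h : star (A * B).trace = (A * B).trace := by
    rw [← trace_conjTranspose, conjTranspose_mul, hA.eq, hB.eq, trace_mul_comm]
  exact Complex.conj_eq_iff_im.mp h

lemma Matrix.IsHermitian.trace_mul_nonneg_iff {A B : Matrix n n ℂ} (hA : A.IsHermitian)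
    (hB : B.IsHermitian) : 0 ≤ (A * B).trace ↔ 0 ≤ (A * B).trace.re := by
  simp [Complex.le_def, hA.im_trace_mul_eq_zero hB]

lemma Matrix.PosSemidef.re_trace_mul_nonneg {A B : Matrix n n ℂ} (hA : A.PosSemidef)
    (hB : B.PosSemidef) : 0 ≤ (A * B).trace.re := by
  obtain ⟨k, v, rfl⟩ := posSemidef_iff_eq_sum_vecMulVec.mp hB
  rw [Finset.mul_sum, trace_sum, Complex.re_sum]
  refine Finset.sum_nonneg fun i _ => ?_
  rw [trace_mul_vecMulVec_star]
  exact hA.re_dotProduct_nonneg _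

lemma Matrix.PosDef.re_trace_mul_pos {A B : Matrix n n ℂ} (hA : A.PosDef)
    (hB : B.PosSemidef) (hB0 : B ≠ 0) : 0 < (A * B).trace.re := by
  obtain ⟨k, v, rfl⟩ := posSemidef_iff_eq_sum_vecMulVec.mp hB
  obtain ⟨i, hi⟩ : ∃ i, v i ≠ 0 := by
    by_contra! h
    exact hB0 (by simp [h])
  rw [Finset.mul_sum, trace_sum, Complex.re_sum]
  refine Finset.sum_pos' (fun i _ => ?_) ⟨i, Finset.mem_univ _, ?_⟩
  · rw [trace_mul_vecMulVec_star]
    exact hA.posSemidef.re_dotProduct_nonneg _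
  · rw [trace_mul_vecMulVec_star]
    exact hA.re_dotProduct_pos hi

instance {n : Type*} : LocallyConvexSpace ℝ (Matrix n n ℂ) :=
  inferInstanceAs (LocallyConvexSpace ℝ (n → n → ℂ))

/-- Real linear functionals on complex matrices are represented, on Hermitian matrices,
by Hermitian matrices through the trace pairing. -/
lemma exists_isHermitian_re_trace_mul_eq [DecidableEq n] (f : Matrix n n ℂ →ₗ[ℝ] ℝ) :
    ∃ ρ : Matrix n n ℂ, ρ.IsHermitian ∧
      ∀ G : Matrix n n ℂ, G.IsHermitian → (G * ρ).trace.re = f G := by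
  let σ : Matrix n n ℂ := fun j i => ⟨f (single i j 1), -f (single i j Complex.I)⟩
  have hσ (G : Matrix n n ℂ) : (G * σ).trace.re = f G := by
    have hs (i j : n) : single i j (G i j) =
        (G i j).re • single i j (1 : ℂ) + (G i j).im • single i j Complex.I := by
      rw [smul_single, smul_single, ← single_add]
      congr 1
      simp [Complex.re_add_im]
    conv_rhs => rw [matrix_eq_sum_single G]
    simp only [trace, diag_apply, mul_apply, Complex.re_sum, map_sum]
    refine Finset.sum_congr rfl fun i _ => Finset.sum_congr rfl fun j _ => ?_
    rw [hs, map_add, map_smul, map_smul]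
    simp [σ, Complex.mul_re]
  refine ⟨(1 / 2 : ℝ) • (σ + σᴴ), ?_, fun G hG => ?_⟩
  · simp [IsHermitian, conjTranspose_smul, add_comm]
  · have h : (G * σᴴ).trace.re = (G * σ).trace.re := by
      have : (G * σᴴ).trace = star (G * σ).trace := by
        rw [← trace_conjTranspose, conjTranspose_mul, hG.eq, trace_mul_comm]
      rw [this]
      simp
    rw [Matrix.mul_smul, trace_smul, mul_add, trace_add, Complex.smul_re, Complex.add_re, h, hσ,
      smul_eq_mul]
    ring

lemma isClosed_setOf_posSemidef : IsClosed {A : Matrix n n ℂ | A.PosSemidef} := by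
  simp only [posSemidef_iff_dotProduct_mulVec, Set.ofPred_and, Set.ofPred_forall]
  refine IsClosed.inter ?_ (isClosed_iInter fun x => ?_)
  · exact isClosed_eq (by fun_prop) continuous_id
  · exact isClosed_le continuous_const (by fun_prop)

/-- A Hermitian matrix outside a closed cone of Hermitian matrices containing the positive
semidefinite ones is separated from that cone by a density matrix. -/
lemma exists_density_separating [DecidableEq n] {K : PointedCone ℝ (Matrix n n ℂ)}
    (hK : IsClosed (K : Set (Matrix n n ℂ))) (hherm : ∀ A ∈ K, A.IsHermitian)
    (hpsd : ∀ A : Matrix n n ℂ, A.PosSemidef → A ∈ K)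
    {G : Matrix n n ℂ} (hG : G.IsHermitian) (hGK : G ∉ K) :
    ∃ ρ : Matrix n n ℂ, (ρ.PosSemidef ∧ ρ.trace = 1) ∧
      (∀ A ∈ K, 0 ≤ (A * ρ).trace.re) ∧ (G * ρ).trace.re < 0 := by
  obtain ⟨f, u, hfG, hfK⟩ := geometric_hahn_banach_point_closed (E := Matrix n n ℂ)
    (PointedCone.toConvexCone K).convex hK hGK
  have hu : u < 0 := by simpa using hfK 0 K.zero_mem
  have hf (A : Matrix n n ℂ) (hA : A ∈ K) : 0 ≤ f A := by
    by_contra! h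
    have h1 := hfK ((u / f A) • A) (K.smul_mem (div_pos_of_neg_of_neg hu h).le hA)
    rw [map_smul, smul_eq_mul, div_mul_cancel₀ _ h.ne] at h1
    exact lt_irrefl _ h1
  obtain ⟨ρ, hρ, hρf⟩ := exists_isHermitian_re_trace_mul_eq (f : Matrix n n ℂ →ₗ[ℝ] ℝ)
  have hρpsd : ρ.PosSemidef := by
    refine .of_dotProduct_mulVec_nonneg hρ fun x => ?_
    have hx := posSemidef_vecMulVec_self_star x
    rw [← trace_mul_vecMulVec_star, hρ.trace_mul_nonneg_iff hx.1, trace_mul_comm, hρf _ hx.1]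
    exact hf _ (hpsd _ hx)
  have hG0 : (G * ρ).trace.re < 0 := by
    rw [hρf G hG]
    exact hfG.trans hu
  have htr : 0 < ρ.trace := by
    refine lt_of_le_of_ne hρpsd.trace_nonneg fun h => ?_
    rw [hρpsd.trace_eq_zero_iff.mp h.symm] at hG0
    simp at hG0
  obtain ⟨htre, htim⟩ := Complex.lt_def.mp htr
  have hinv : 0 < ρ.trace.re⁻¹ := inv_pos.mpr htre
  have key (A : Matrix n n ℂ) :
      (A * (ρ.trace.re⁻¹ • ρ)).trace.re = ρ.trace.re⁻¹ * (A * ρ).trace.re := by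
    rw [Matrix.mul_smul, trace_smul, Complex.smul_re, smul_eq_mul]
  refine ⟨ρ.trace.re⁻¹ • ρ, ⟨hρpsd.smul hinv.le, ?_⟩, fun A hA => ?_, ?_⟩
  · rw [trace_smul]
    apply Complex.ext
    · simpa using inv_mul_cancel₀ htre.ne'
    · simpa using Or.inr htim.symm
  · rw [key, hρf A (hherm A hA)]
    exact mul_nonneg hinv.le (hf A hA)
  · rw [key]
    exact mul_neg_of_pos_of_neg hinv hG0

end MatrixTrace

section Polarization

variable {m : ℕ} {nd : Fin m → ℕ}

/-- The sesquilinear form of a matrix evaluated at two product vectors. -/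
def kronForm (G : Matrix (QIdx m nd) (QIdx m nd) ℂ) (x y : ∀ j, Fin (nd j) → ℂ) : ℂ :=
  star (kronVec x) ⬝ᵥ G *ᵥ kronVec y

lemma kronVec_update_add_smul (x : ∀ j, Fin (nd j) → ℂ) (a : Fin m) (c : ℂ)
    (u v : Fin (nd a) → ℂ) :
    kronVec (Function.update x a (u + c • v)) =
      kronVec (Function.update x a u) + c • kronVec (Function.update x a v) := by
  have h (w : Fin (nd a) → ℂ) (k : QIdx m nd) :
      kronVec (Function.update x a w) k = w (k a) * ∏ j ∈ Finset.univ.erase a, x j (k j) := by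
    rw [kronVec, ← Finset.mul_prod_erase _ _ (Finset.mem_univ a), Function.update_self]
    congr 1
    refine Finset.prod_congr rfl fun j hj => ?_
    rw [Function.update_of_ne (Finset.ne_of_mem_erase hj)]
  ext k
  simp only [Pi.add_apply, Pi.smul_apply, smul_eq_mul, h]
  ring

lemma kronVec_smul (c : Fin m → ℂ) (x : ∀ j, Fin (nd j) → ℂ) :
    kronVec (fun j => c j • x j) = (∏ j, c j) • kronVec x := by
  ext k
  simp [kronVec, Finset.prod_mul_distrib]

lemma kronVec_single (k : QIdx m nd) :
    kronVec (fun j => Pi.single (k j) (1 : ℂ)) = Pi.single k 1 := by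
  ext l
  by_cases h : l = k
  · subst h
    simp [kronVec]
  · obtain ⟨j, hj⟩ := Function.ne_iff.mp h
    rw [Pi.single_eq_of_ne h, kronVec]
    exact Finset.prod_eq_zero (Finset.mem_univ j) (Pi.single_eq_of_ne hj _)

lemma kronForm_eq_zero_of_diag_eq_zero {G : Matrix (QIdx m nd) (QIdx m nd) ℂ}
    (h : ∀ x, kronForm G x x = 0) (x y : ∀ j, Fin (nd j) → ℂ) : kronForm G x y = 0 := by
  suffices H : ∀ (s : Finset (Fin m)) (x y : ∀ j, Fin (nd j) → ℂ), (∀ j ∉ s, x j = y j) →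
      kronForm G x y = 0 from H Finset.univ x y (by simp)
  intro s
  induction s using Finset.induction_on with
  | empty =>
    intro x y hxy
    rw [funext fun j => hxy j (Finset.notMem_empty j)]
    exact h y
  | insert a s _ ih =>
    intro x y hxy
    have hdiag (w : Fin (nd a) → ℂ) :
        kronForm G (Function.update x a w) (Function.update y a w) = 0 := by
      refine ih _ _ fun j hj => ?_
      by_cases hja : j = a
      · subst hja
        simp
      · rw [Function.update_of_ne hja, Function.update_of_ne hja]
        exact hxy j (by simp [hja, hj])
    have hexp (c : ℂ) := hdiag (x a + c • y a)
    have h1 := hdiag (x a)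
    have h2 := hdiag (y a)
    simp only [kronForm, kronVec_update_add_smul, star_add, star_smul, add_dotProduct,
      smul_dotProduct, mulVec_add, mulVec_smul, dotProduct_add, dotProduct_smul, smul_eq_mul,
      Function.update_eq_self] at hexp h1 h2 ⊢
    have e1 := hexp 1
    have eI := hexp Complex.I
    simp only [star_one, Complex.star_def, Complex.conj_I] at e1 eI
    rw [h1, h2] at e1 eI
    linear_combination (1 / 2 : ℂ) * e1 - (Complex.I / 2) * eI
      + (1 / 2 : ℂ) * ((star (kronVec x) ⬝ᵥ G *ᵥ kronVec y)
        - star (kronVec (Function.update x a (y a))) ⬝ᵥ G *ᵥ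
          kronVec (Function.update y a (x a))) * Complex.I_mul_I

lemma exists_eq_smul_unit {k : ℕ} {v : Fin k → ℂ} (hv : v ≠ 0) :
    ∃ (c : ℂ) (w : Fin k → ℂ), star w ⬝ᵥ w = 1 ∧ v = c • w := by
  obtain ⟨hre, him⟩ := Complex.lt_def.mp (dotProduct_star_self_pos_iff.mpr hv)
  set r := (star v ⬝ᵥ v).re with hr
  have hrr : star v ⬝ᵥ v = (r : ℂ) := Complex.ext rfl (by simpa using him.symm)
  have hr0 : 0 < r := by simpa using hre
  have hs : ((Real.sqrt r : ℝ) : ℂ) ≠ 0 := by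
    simpa using (Real.sqrt_pos.mpr hr0).ne'
  refine ⟨(Real.sqrt r : ℝ), ((Real.sqrt r : ℝ) : ℂ)⁻¹ • v, ?_, ?_⟩
  · rw [star_smul, smul_dotProduct, dotProduct_smul, hrr]
    have : ((Real.sqrt r : ℝ) : ℂ) * (Real.sqrt r : ℝ) = r := by
      rw [← Complex.ofReal_mul, Real.mul_self_sqrt hr0.le]
    simp only [star_inv₀, Complex.star_def, Complex.conj_ofReal, smul_eq_mul]
    rw [← this]
    field_simp
  · rw [smul_smul, mul_inv_cancel₀ hs, one_smul]

lemma kronForm_self_im {G : Matrix (QIdx m nd) (QIdx m nd) ℂ} (hG : G.IsHermitian)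
    (x : ∀ j, Fin (nd j) → ℂ) : (kronForm G x x).im = 0 :=
  hG.im_star_dotProduct_mulVec_self _

lemma eq_zero_of_qGamble_eq_zero {G : Matrix (QIdx m nd) (QIdx m nd) ℂ} (hG : G.IsHermitian)
    (h : qGamble G = 0) : G = 0 := by
  have hdiag (x : ∀ j, Fin (nd j) → ℂ) : kronForm G x x = 0 := by
    by_cases hx : ∃ j, x j = 0
    · obtain ⟨j, hj⟩ := hx
      have : kronVec x = 0 := by
        ext k
        exact Finset.prod_eq_zero (Finset.mem_univ j) (by simp [hj])
      simp [kronForm, this]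
    · push Not at hx
      choose c w hw hcw using fun j => exists_eq_smul_unit (hx j)
      have h0 : kronForm G w w = 0 :=
        Complex.ext (congrFun h fun j => ⟨w j, hw j⟩) (kronForm_self_im hG w)
      rw [funext hcw, kronForm, kronVec_smul, star_smul, smul_dotProduct, mulVec_smul,
        dotProduct_smul]
      rw [kronForm] at h0
      simp [h0]
  ext k l
  have := kronForm_eq_zero_of_diag_eq_zero hdiag (fun j => Pi.single (k j) 1)
    (fun j => Pi.single (l j) 1)
  rw [kronForm, kronVec_single, kronVec_single] at this
  simpa using this

end Polarization

section Gambles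

variable {m : ℕ} {nd : Fin m → ℕ}

/-- `qGamble` as a real linear map. -/
def qGambleLin (m : ℕ) (nd : Fin m → ℕ) :
    Matrix (QIdx m nd) (QIdx m nd) ℂ →ₗ[ℝ] (QOmega m nd → ℝ) where
  toFun := qGamble
  map_add' A B := by
    ext x
    simp [qGamble, add_mulVec]
  map_smul' c A := by
    ext x
    simp [qGamble, smul_mulVec]

lemma qGambleLin_apply (G : Matrix (QIdx m nd) (QIdx m nd) ℂ) :
    qGambleLin m nd G = qGamble G := rfl

/-- The real subspace of Hermitian matrices. -/
abbrev hermitianSubmodule (m : ℕ) (nd : Fin m → ℕ) :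
    Submodule ℝ (Matrix (QIdx m nd) (QIdx m nd) ℂ) :=
  selfAdjoint.submodule ℝ (Matrix (QIdx m nd) (QIdx m nd) ℂ)

lemma qGamble_injOn {A B : Matrix (QIdx m nd) (QIdx m nd) ℂ} (hA : A.IsHermitian)
    (hB : B.IsHermitian) (h : qGamble A = qGamble B) : A = B := by
  refine sub_eq_zero.mp (eq_zero_of_qGamble_eq_zero (hA.sub hB) ?_)
  rw [← qGambleLin_apply, map_sub, qGambleLin_apply, qGambleLin_apply, h, sub_self]

lemma isClosedEmbedding_qGambleLin_domRestrict :
    Topology.IsClosedEmbedding ((qGambleLin m nd).domRestrict (hermitianSubmodule m nd)) := by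
  refine LinearMap.isClosedEmbedding_of_injective (LinearMap.ker_eq_bot.mpr ?_)
  intro A B h
  exact Subtype.ext (qGamble_injOn A.2 B.2 h)

lemma isClosed_image_qGamble {K : Set (Matrix (QIdx m nd) (QIdx m nd) ℂ)} (hK : IsClosed K)
    (hherm : ∀ A ∈ K, A.IsHermitian) : IsClosed (qGamble '' K) := by
  have h := (isClosedEmbedding_qGambleLin_domRestrict (m := m) (nd := nd)).isClosedMap _
    (hK.preimage continuous_subtype_val)
  convert h using 1
  ext g
  constructor
  · rintro ⟨A, hA, rfl⟩
    exact ⟨⟨A, hherm A hA⟩, hA, rfl⟩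
  · rintro ⟨A, hA, rfl⟩
    exact ⟨A, hA, rfl⟩

lemma LRq_eq_image : LRq m nd = qGamble '' {G | G.IsHermitian} := by
  ext g
  simp only [LRq, Set.mem_ofPred_eq, Set.mem_image, eq_comm]

lemma isClosed_LRq : IsClosed (LRq m nd) := by
  rw [LRq_eq_image]
  exact isClosed_image_qGamble
    (isClosed_eq (continuous_id.matrix_conjTranspose) continuous_id) fun _ h => h

lemma posi_eq_hull (S : Set (QOmega m nd → ℝ)) : posi S = (PointedCone.hull ℝ S : Set _) := by
  ext g
  rw [SetLike.mem_coe, PointedCone.hull, Submodule.mem_span_set']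
  constructor
  · rintro ⟨l, c, gs, hc, hgs, rfl⟩
    refine ⟨l, fun i => ⟨c i, hc i⟩, fun i => ⟨gs i, hgs i⟩, ?_⟩
    ext x
    simp [Finset.sum_apply, Nonneg.mk_smul]
  · rintro ⟨l, c, gs, rfl⟩
    refine ⟨l, fun i => c i, fun i => gs i, fun i => (c i).2, fun i => (gs i).2, ?_⟩
    ext x
    rw [Finset.sum_apply]
    rfl

/-- Hermitian matrices as a pointed cone. -/
def hermitianCone (m : ℕ) (nd : Fin m → ℕ) :
    PointedCone ℝ (Matrix (QIdx m nd) (QIdx m nd) ℂ) :=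
  (hermitianSubmodule m nd).restrictScalars _

/-- The Hermitian matrices whose gambles lie in a P-coherent set form a closed cone containing
the positive semidefinite matrices, and all gambles of that set arise from them. -/
lemma PCoh.exists_cone {C : Set (QOmega m nd → ℝ)} (hC : PCoh m nd C) :
    ∃ K : PointedCone ℝ (Matrix (QIdx m nd) (QIdx m nd) ℂ),
      IsClosed (K : Set (Matrix (QIdx m nd) (QIdx m nd) ℂ)) ∧
      (∀ A, A ∈ K ↔ A.IsHermitian ∧ qGamble A ∈ C) ∧
      (∀ A : Matrix (QIdx m nd) (QIdx m nd) ℂ, A.PosSemidef → A ∈ K) ∧ C ⊆ LRq m nd := by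
  obtain ⟨⟨𝒢, h𝒢, rfl⟩, -⟩ := hC
  set S := SigmaPSD m nd ∪ 𝒢 with hS
  have hSL : S ⊆ LRq m nd := by
    rintro g (⟨G, hG, rfl⟩ | hg)
    · exact ⟨G, hG.1, rfl⟩
    · exact h𝒢 hg
  let T : PointedCone ℝ (QOmega m nd → ℝ) := (PointedCone.hull ℝ S).topologicalClosure
  have hT : (T : Set (QOmega m nd → ℝ)) = closure (posi S) := by
    rw [posi_eq_hull]
    rfl
  have hST : S ⊆ T := by
    rw [hT, posi_eq_hull]
    exact Submodule.subset_span.trans subset_closure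
  have hmem (A : Matrix (QIdx m nd) (QIdx m nd) ℂ) :
      A ∈ T.comap (qGambleLin m nd) ⊓ hermitianCone m nd ↔
        A.IsHermitian ∧ qGamble A ∈ closure (posi S) := by
    rw [← hT]
    exact and_comm
  refine ⟨T.comap (qGambleLin m nd) ⊓ hermitianCone m nd, ?_, hmem, fun A hA => ?_, ?_⟩
  · have : IsClosed {A : Matrix (QIdx m nd) (QIdx m nd) ℂ |
        A.IsHermitian ∧ qGamble A ∈ closure (posi S)} :=
      (isClosed_eq continuous_id.matrix_conjTranspose continuous_id).inter
        (isClosed_closure.preimage (qGambleLin m nd).continuous_of_finiteDimensional)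
    convert this using 1
    ext A
    exact hmem A
  · rw [hmem, ← hT]
    exact ⟨hA.1, hST (Or.inl ⟨A, hA, rfl⟩)⟩
  · refine closure_minimal ?_ isClosed_LRq
    have hle : PointedCone.hull ℝ S ≤ (hermitianCone m nd).map (qGambleLin m nd) := by
      refine Submodule.span_le.mpr fun g hg => ?_
      obtain ⟨G, hG, rfl⟩ := hSL hg
      exact ⟨G, hG, rfl⟩
    rw [posi_eq_hull]
    intro g hg
    obtain ⟨G, hG, rfl⟩ := hle hg
    exact ⟨G, hG, rfl⟩

/-- Bipolar property: outside a P-coherent set, some element of the dual set is negative. -/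
lemma PCoh.exists_mem_QMap {C : Set (QOmega m nd → ℝ)} (hC : PCoh m nd C)
    {G : Matrix (QIdx m nd) (QIdx m nd) ℂ} (hG : G.IsHermitian) (hGC : qGamble G ∉ C) :
    ∃ ρ ∈ QMap m nd C, (G * ρ).trace.re < 0 := by
  obtain ⟨K, hK, hmem, hpsd, -⟩ := hC.exists_cone
  obtain ⟨ρ, hρ, hρK, hρG⟩ := exists_density_separating hK (fun A hA => ((hmem A).mp hA).1) hpsd
    hG fun h => hGC ((hmem G).mp h).2
  exact ⟨ρ, ⟨hρ, fun A hA hAC => (hA.trace_mul_nonneg_iff hρ.1.1).mpr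
    (hρK A ((hmem A).mpr ⟨hA, hAC⟩))⟩, hρG⟩

lemma PCoh.nonempty_QMap {C : Set (QOmega m nd → ℝ)} (hC : PCoh m nd C) :
    (QMap m nd C).Nonempty := by
  have hone : qGamble (-1 : Matrix (QIdx m nd) (QIdx m nd) ℂ) ∉ C := fun h =>
    Set.eq_empty_iff_forall_notMem.mp hC.2 _ ⟨h, -1, by simpa using PosDef.one, rfl⟩
  obtain ⟨ρ, hρ, -⟩ := hC.exists_mem_QMap isHermitian_one.neg hone
  exact ⟨ρ, hρ⟩

lemma PCoh.subset_of_QMap_subset {C C' : Set (QOmega m nd → ℝ)} (hC : PCoh m nd C)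
    (hC' : PCoh m nd C') (h : QMap m nd C' ⊆ QMap m nd C) : C ⊆ C' := by
  obtain ⟨-, -, -, -, hL⟩ := hC.exists_cone
  intro g hg
  obtain ⟨G, hG, rfl⟩ := hL hg
  by_contra hn
  obtain ⟨ρ, hρ, hneg⟩ := hC'.exists_mem_QMap hG hn
  exact not_lt.mpr (Complex.le_def.mp ((h hρ).2 G hG hg)).1 hneg

lemma isClosed_QMap (C : Set (QOmega m nd → ℝ)) : IsClosed (QMap m nd C) := by
  simp only [QMap, densities, Set.ofPred_and, Set.ofPred_forall]
  refine (isClosed_setOf_posSemidef.inter ?_).inter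
    (isClosed_iInter fun G => isClosed_iInter fun _ => isClosed_iInter fun _ => ?_)
  · exact isClosed_eq (by fun_prop) continuous_const
  · exact isClosed_le continuous_const (by fun_prop)

lemma convex_QMap (C : Set (QOmega m nd → ℝ)) : Convex ℝ (QMap m nd C) := by
  rintro ρ ⟨⟨hρ, hρt⟩, hρC⟩ σ ⟨⟨hσ, hσt⟩, hσC⟩ a b ha hb hab
  refine ⟨⟨(hρ.smul ha).add (hσ.smul hb), ?_⟩, fun G hG hGC => ?_⟩
  · rw [trace_add, trace_smul, trace_smul, hρt, hσt, ← add_smul, hab, one_smul]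
  · rw [mul_add, Matrix.mul_smul, Matrix.mul_smul, trace_add, trace_smul, trace_smul]
    exact add_nonneg (smul_nonneg ha (hρC G hG hGC)) (smul_nonneg hb (hσC G hG hGC))

/-- The cone of Hermitian matrices pairing nonnegatively with every matrix in `D`. -/
def dualCone (D : Set (Matrix (QIdx m nd) (QIdx m nd) ℂ)) :
    PointedCone ℝ (Matrix (QIdx m nd) (QIdx m nd) ℂ) where
  carrier := {G | G.IsHermitian ∧ ∀ ρ ∈ D, 0 ≤ (G * ρ).trace.re}
  zero_mem' := ⟨isHermitian_zero, by simp⟩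
  add_mem' := by
    rintro A B ⟨hA, hAD⟩ ⟨hB, hBD⟩
    refine ⟨hA.add hB, fun ρ hρ => ?_⟩
    rw [add_mul, trace_add, Complex.add_re]
    exact add_nonneg (hAD ρ hρ) (hBD ρ hρ)
  smul_mem' := by
    rintro ⟨c, hc⟩ A ⟨hA, hAD⟩
    refine ⟨(hermitianCone m nd).smul_mem hc hA, fun ρ hρ => ?_⟩
    rw [Nonneg.mk_smul, smul_mul, trace_smul, Complex.smul_re, smul_eq_mul]
    exact mul_nonneg hc (hAD ρ hρ)

lemma isClosed_dualCone (D : Set (Matrix (QIdx m nd) (QIdx m nd) ℂ)) :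
    IsClosed (dualCone D : Set (Matrix (QIdx m nd) (QIdx m nd) ℂ)) := by
  change IsClosed {G : Matrix (QIdx m nd) (QIdx m nd) ℂ |
    G.IsHermitian ∧ ∀ ρ ∈ D, 0 ≤ (G * ρ).trace.re}
  simp only [Set.ofPred_and, Set.ofPred_forall]
  refine (isClosed_eq continuous_id.matrix_conjTranspose continuous_id).inter
    (isClosed_iInter fun ρ => isClosed_iInter fun _ => isClosed_le continuous_const ?_)
  fun_prop

lemma pCoh_image_dualCone {D : Set (Matrix (QIdx m nd) (QIdx m nd) ℂ)}
    (hD : D ⊆ densities m nd) (hne : D.Nonempty) :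
    PCoh m nd (qGamble '' (dualCone D : Set (Matrix (QIdx m nd) (QIdx m nd) ℂ))) := by
  refine ⟨⟨qGamble '' (dualCone D : Set (Matrix (QIdx m nd) (QIdx m nd) ℂ)), ?_, ?_⟩, ?_⟩
  · rintro _ ⟨G, hG, rfl⟩
    exact ⟨G, hG.1, rfl⟩
  · have hpsd : SigmaPSD m nd ⊆
        qGamble '' (dualCone D : Set (Matrix (QIdx m nd) (QIdx m nd) ℂ)) := by
      rintro _ ⟨G, hG, rfl⟩
      exact ⟨G, ⟨hG.1, fun ρ hρ => hG.re_trace_mul_nonneg (hD hρ).1⟩, rfl⟩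
    have hmap : qGamble '' (dualCone D : Set (Matrix (QIdx m nd) (QIdx m nd) ℂ)) =
        ((dualCone D).map (qGambleLin m nd) : Set (QOmega m nd → ℝ)) := rfl
    rw [Set.union_eq_self_of_subset_left hpsd, posi_eq_hull]
    conv_rhs => rw [hmap, PointedCone.hull, Submodule.span_eq, ← hmap]
    exact (isClosed_image_qGamble (isClosed_dualCone D) fun A hA => hA.1).closure_eq.symm
  · rw [Set.eq_empty_iff_forall_notMem]
    rintro _ ⟨⟨G, hG, rfl⟩, N, hN, hGN⟩
    have hNH : N.IsHermitian := by simpa using hN.1.neg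
    obtain rfl := qGamble_injOn hG.1 hNH hGN
    obtain ⟨ρ, hρ⟩ := hne
    have h0 : ρ ≠ 0 := by
      rintro rfl
      simpa using (hD hρ).2
    have h1 := hN.re_trace_mul_pos (hD hρ).1 h0
    rw [neg_mul, trace_neg, Complex.neg_re] at h1
    linarith [hG.2 ρ hρ]

lemma QMap_image_dualCone {D : Set (Matrix (QIdx m nd) (QIdx m nd) ℂ)}
    (hD : D ⊆ densities m nd) (hcl : IsClosed D) (hcv : Convex ℝ D) :
    QMap m nd (qGamble '' (dualCone D : Set (Matrix (QIdx m nd) (QIdx m nd) ℂ))) = D := by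
  refine Set.Subset.antisymm (fun σ hσ => ?_) fun ρ hρ => ⟨hD hρ, ?_⟩
  · by_contra hn
    obtain ⟨f, u, hfσ, hfD⟩ := geometric_hahn_banach_point_closed hcv hcl hn
    obtain ⟨A, hA, hAf⟩ := exists_isHermitian_re_trace_mul_eq
      (f : Matrix (QIdx m nd) (QIdx m nd) ℂ →ₗ[ℝ] ℝ)
    have hB : (A - u • (1 : Matrix (QIdx m nd) (QIdx m nd) ℂ)).IsHermitian :=
      (hermitianSubmodule m nd).sub_mem hA
        ((hermitianSubmodule m nd).smul_mem u isHermitian_one)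
    have key (ρ : Matrix (QIdx m nd) (QIdx m nd) ℂ) (hρ : ρ ∈ densities m nd) :
        ((A - u • (1 : Matrix (QIdx m nd) (QIdx m nd) ℂ)) * ρ).trace.re = f ρ - u := by
      rw [sub_mul, smul_mul, one_mul, trace_sub, trace_smul, hρ.2, trace_mul_comm,
        Complex.sub_re, hAf ρ hρ.1.1]
      simp
    have h1 := (Complex.le_def.mp (hσ.2 _ hB ⟨_, ⟨hB, fun ρ hρ => by
      rw [key ρ (hD hρ)]
      exact (sub_pos.mpr (hfD ρ hρ)).le⟩, rfl⟩)).1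
    rw [key σ hσ.1, Complex.zero_re] at h1
    linarith
  · rintro G hG ⟨A, hA, hAG⟩
    obtain rfl := qGamble_injOn hA.1 hG hAG
    exact (hG.trace_mul_nonneg_iff (hD hρ).1.1).mpr (hA.2 ρ hρ)

end Gambles

/-- `C ↦ 𝒬(C)` is a bijection between P-coherent sets of desirable
gambles and nonempty closed convex sets of density matrices. -/
theorem stmt12 (m : ℕ) (hm : 1 ≤ m) (nd : Fin m → ℕ) (hnd : ∀ j, 1 ≤ nd j) :
    (∀ C : Set (QOmega m nd → ℝ), PCoh m nd C →
      (QMap m nd C).Nonempty ∧ IsClosed (QMap m nd C) ∧ Convex ℝ (QMap m nd C) ∧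
        QMap m nd C ⊆ densities m nd)
    ∧ (∀ C C' : Set (QOmega m nd → ℝ), PCoh m nd C → PCoh m nd C' →
        QMap m nd C = QMap m nd C' → C = C')
    ∧ (∀ D : Set (Matrix (QIdx m nd) (QIdx m nd) ℂ), D ⊆ densities m nd →
        D.Nonempty → IsClosed D → Convex ℝ D →
        ∃ C : Set (QOmega m nd → ℝ), PCoh m nd C ∧ QMap m nd C = D) := by
  refine ⟨fun C hC => ⟨hC.nonempty_QMap, isClosed_QMap C, convex_QMap C, fun _ h => h.1⟩,
    fun C C' hC hC' h => ?_, fun D hD hne hcl hcv => ?_⟩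
  · exact (hC.subset_of_QMap_subset hC' h.ge).antisymm (hC'.subset_of_QMap_subset hC h.le)
  · exact ⟨_, pCoh_image_dualCone hD hne, QMap_image_dualCone hD hcl hcv⟩
end
end

section
/- Let σ_x = [[0,1],[1,0]] and σ_z = [[1,0],[0,−1]], and for α ∈ ℝ set G_α := (sin α)σ_x + (cos α)σ_z. Then for all α₁, α₂, β₁, β₂ ∈ ℝ and all unit vectors x, y ∈ ℂ² (x†x = y†y = 1): (x⊗y)†(G_{α₁}⊗G_{β₁} − G_{α₁}⊗G_{β₂} + G_{α₂}⊗G_{β₁} + G_{α₂}⊗G_{β₂})(x⊗y) ≤ 2 (the CHSH inequality for product states). -/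
open Matrix Kronecker
open scoped ComplexOrder

noncomputable section

/-- The Pauli matrix `σ_x`. -/
def sigmaX : Matrix (Fin 2) (Fin 2) ℂ := !![0, 1; 1, 0]

/-- The Pauli matrix `σ_z`. -/
def sigmaZ : Matrix (Fin 2) (Fin 2) ℂ := !![1, 0; 0, -1]

/-- `G_α = sin(α) σ_x + cos(α) σ_z`. -/
def Gmat (α : ℝ) : Matrix (Fin 2) (Fin 2) ℂ :=
  (Real.sin α : ℂ) • sigmaX + (Real.cos α : ℂ) • sigmaZ

/-- The Kronecker product of column vectors `x, y ∈ ℂ²`. -/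
def vKron (x y : Fin 2 → ℂ) : Fin 2 × Fin 2 → ℂ := fun p => x p.1 * y p.2

/-- Quadratic forms of Kronecker products factor on product vectors. -/
lemma quadForm_kronecker_vKron (A B : Matrix (Fin 2) (Fin 2) ℂ) (x y : Fin 2 → ℂ) :
    star (vKron x y) ⬝ᵥ (A ⊗ₖ B) *ᵥ vKron x y =
      (star x ⬝ᵥ A *ᵥ x) * (star y ⬝ᵥ B *ᵥ y) := by
  simp only [dotProduct, mulVec, vKron, Fintype.sum_prod_type, Fin.sum_univ_two,
    Pi.star_apply, star_mul', kroneckerMap_apply]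
  ring

/-- The expectation of `G_α` in a unit vector is a real number in `[-1, 1]`. -/
lemma exists_quadForm_Gmat_eq (α : ℝ) (x : Fin 2 → ℂ) (hx : star x ⬝ᵥ x = 1) :
    ∃ g : ℝ, star x ⬝ᵥ Gmat α *ᵥ x = (g : ℂ) ∧ |g| ≤ 1 := by
  rcases h0 : x 0 with ⟨a, b⟩
  rcases h1 : x 1 with ⟨c, d⟩
  have hn : a ^ 2 + b ^ 2 + c ^ 2 + d ^ 2 = 1 := by
    have h := congrArg Complex.re hx
    simp [dotProduct, Fin.sum_univ_two, h0, h1] at h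
    linarith
  refine ⟨Real.sin α * (2 * (a * c + b * d)) +
    Real.cos α * (a ^ 2 + b ^ 2 - c ^ 2 - d ^ 2), ?_, ?_⟩
  · apply Complex.ext
    · simp [dotProduct, mulVec, Fin.sum_univ_two, Gmat, sigmaX, sigmaZ, h0, h1,
        -Complex.ofReal_sin, -Complex.ofReal_cos, -Complex.ofReal_pow]
      ring
    · simp [dotProduct, mulVec, Fin.sum_univ_two, Gmat, sigmaX, sigmaZ, h0, h1,
        -Complex.ofReal_sin, -Complex.ofReal_cos, -Complex.ofReal_pow]
      ring
  · rw [← sq_le_one_iff_abs_le_one]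
    set p := 2 * (a * c + b * d) with hp
    set q := a ^ 2 + b ^ 2 - c ^ 2 - d ^ 2 with hq
    have hpq : p ^ 2 + q ^ 2 ≤ 1 := by
      have h : p ^ 2 + q ^ 2 + (2 * (a * d - b * c)) ^ 2 =
          (a ^ 2 + b ^ 2 + c ^ 2 + d ^ 2) ^ 2 := by
        rw [hp, hq]; ring
      rw [hn] at h
      nlinarith [sq_nonneg (2 * (a * d - b * c))]
    have h : (Real.sin α * p + Real.cos α * q) ^ 2 + (Real.sin α * q - Real.cos α * p) ^ 2 =
        (Real.sin α ^ 2 + Real.cos α ^ 2) * (p ^ 2 + q ^ 2) := by ring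
    rw [Real.sin_sq_add_cos_sq] at h
    nlinarith [sq_nonneg (Real.sin α * q - Real.cos α * p)]

/-- The CHSH bound for real numbers in `[-1, 1]`. -/
lemma chsh_le_two {a₁ a₂ b₁ b₂ : ℝ} (ha₁ : |a₁| ≤ 1) (ha₂ : |a₂| ≤ 1)
    (hb₁ : |b₁| ≤ 1) (hb₂ : |b₂| ≤ 1) :
    a₁ * b₁ - a₁ * b₂ + a₂ * b₁ + a₂ * b₂ ≤ 2 := by
  have h₁ : a₁ * (b₁ - b₂) ≤ |b₁ - b₂| := by
    refine (le_abs_self _).trans ?_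
    rw [abs_mul]
    exact mul_le_of_le_one_left (abs_nonneg _) ha₁
  have h₂ : a₂ * (b₁ + b₂) ≤ |b₁ + b₂| := by
    refine (le_abs_self _).trans ?_
    rw [abs_mul]
    exact mul_le_of_le_one_left (abs_nonneg _) ha₂
  have h₃ : |b₁ - b₂| + |b₁ + b₂| ≤ 2 := by
    rw [abs_le] at hb₁ hb₂
    rcases abs_cases (b₁ - b₂) with h | h <;> rcases abs_cases (b₁ + b₂) with h' | h' <;>
      linarith
  linarith

/-- CHSH inequality for product states: for all angles
`α₁, α₂, β₁, β₂` and all unit vectors `x, y ∈ ℂ²`,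
`(x⊗y)† (G_{α₁}⊗G_{β₁} − G_{α₁}⊗G_{β₂} + G_{α₂}⊗G_{β₁} + G_{α₂}⊗G_{β₂}) (x⊗y) ≤ 2`. -/
theorem stmt18 (α₁ α₂ β₁ β₂ : ℝ) (x y : Fin 2 → ℂ)
    (hx : star x ⬝ᵥ x = 1) (hy : star y ⬝ᵥ y = 1) :
    star (vKron x y) ⬝ᵥ
        (Gmat α₁ ⊗ₖ Gmat β₁ - Gmat α₁ ⊗ₖ Gmat β₂ + Gmat α₂ ⊗ₖ Gmat β₁ +
          Gmat α₂ ⊗ₖ Gmat β₂) *ᵥ vKron x y ≤ 2 := by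
  obtain ⟨a₁, ha₁, ha₁'⟩ := exists_quadForm_Gmat_eq α₁ x hx
  obtain ⟨a₂, ha₂, ha₂'⟩ := exists_quadForm_Gmat_eq α₂ x hx
  obtain ⟨b₁, hb₁, hb₁'⟩ := exists_quadForm_Gmat_eq β₁ y hy
  obtain ⟨b₂, hb₂, hb₂'⟩ := exists_quadForm_Gmat_eq β₂ y hy
  simp only [add_mulVec, sub_mulVec, dotProduct_add, dotProduct_sub,
    quadForm_kronecker_vKron, ha₁, ha₂, hb₁, hb₂]
  exact_mod_cast chsh_le_two ha₁' ha₂' hb₁' hb₂'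
end
end
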